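/- arXiv:1208.2856 — 2 statements merged into one kernel-verified Lean document; each statement's English description precedes it below -/
import Mathlib

section
/- For every n ≥ 0, the abelian complexity function ρ of the ordinary paperfolding word satisfies ρ(16n+1) = ρ(8n+1). -/
/-- The ordinary paperfolding word over `{0,1}`, indexed from 1:
writing `n = n' * 2^k` with `n'` odd, `pf n = 0` if `n' ≡ 1 (mod 4)`
and `pf n = 1` if `n' ≡ 3 (mod 4)`.  (The value at `0` is irrelevant.) -/
def pf (n : ℕ) : ℕ := if (n / 2 ^ (n.factorization 2)) % 4 = 1 then 0 else 1

/-- The factor `f_i f_{i+1} ⋯ f_{i+n-1}` of the paperfolding word,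
of length `n`, starting at position `i`. -/
def pfFactor (i n : ℕ) : List ℕ := (List.range n).map (fun j => pf (i + j))

/-- `w` is a factor of the ordinary paperfolding word. -/
def IsPFFactor (w : List ℕ) : Prop := ∃ i : ℕ, 1 ≤ i ∧ w = pfFactor i w.length

/-- The abelian complexity function of the ordinary paperfolding word:
the number of abelian equivalence classes of factors of length `n`,
where the class of a factor `w` is determined by the pair
`(|w|_0, |w|_1)` of numbers of occurrences of `0` and `1` in `w`. -/
noncomputable def ρ (n : ℕ) : ℕ :=
  {p : ℕ × ℕ | ∃ i : ℕ, 1 ≤ i ∧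
    p = ((pfFactor i n).count 0, (pfFactor i n).count 1)}.ncard

/-- `Δ w = |w|_0 - |w|_1`. -/
def Δ (w : List ℕ) : ℤ := (w.count 0 : ℤ) - (w.count 1 : ℤ)

/-- `M n` is the maximum of `Δ w` over all factors `w` of the
paperfolding word of length `n`. -/
noncomputable def M (n : ℕ) : ℤ :=
  sSup {d : ℤ | ∃ i : ℕ, 1 ≤ i ∧ d = Δ (pfFactor i n)}

lemma pf_two_mul (n : ℕ) : pf (2 * n) = pf n := by
  rcases Nat.eq_zero_or_pos n with rfl | hn
  · rfl
  · have h : (2 * n).factorization 2 = n.factorization 2 + 1 := by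
      rw [Nat.factorization_mul two_ne_zero hn.ne']
      simp [Nat.prime_two.factorization, add_comm]
    rw [pf, pf, h, pow_succ', Nat.mul_div_mul_left _ _ two_pos]

lemma pf_of_odd {n : ℕ} (h : n % 2 = 1) : pf n = if n % 4 = 1 then 0 else 1 := by
  have : n.factorization 2 = 0 := Nat.factorization_eq_zero_of_not_dvd (by omega)
  simp [pf, this]

lemma pf_eq_zero_or_one (n : ℕ) : pf n = 0 ∨ pf n = 1 := by
  unfold pf
  split_ifs <;> simp

/-- The paperfolding word over the alphabet `{1, -1}`. -/
def pfSign (n : ℕ) : ℤ := 1 - 2 * pf n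

lemma pfSign_two_mul (n : ℕ) : pfSign (2 * n) = pfSign n := by
  rw [pfSign, pfSign, pf_two_mul]

lemma pfSign_of_mod_four_eq_one {n : ℕ} (h : n % 4 = 1) : pfSign n = 1 := by
  simp [pfSign, pf_of_odd (show n % 2 = 1 by omega), h]

lemma pfSign_of_mod_four_eq_three {n : ℕ} (h : n % 4 = 3) : pfSign n = -1 := by
  simp [pfSign, pf_of_odd (show n % 2 = 1 by omega), h]

lemma pfSign_add_four_mul {m : ℕ} (h : m % 2 = 1) (n : ℕ) :
    pfSign (m + 4 * n) = pfSign m := by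
  rw [pfSign, pfSign, pf_of_odd h, pf_of_odd (by omega), Nat.add_mul_mod_self_left]

lemma pfSign_add_eight_mul {m : ℕ} (h : m % 4 = 2) (n : ℕ) :
    pfSign (m + 8 * n) = pfSign m := by
  obtain ⟨k, rfl⟩ : ∃ k, m = 2 * k := ⟨m / 2, by omega⟩
  rw [show 2 * k + 8 * n = 2 * (k + 4 * n) by ring, pfSign_two_mul, pfSign_two_mul,
    pfSign_add_four_mul (by omega)]

/-- The sum of the signs of the factor of length `n` starting at position `i`. -/
def pfSum (i n : ℕ) : ℤ := ∑ j ∈ Finset.range n, pfSign (i + j)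

lemma pfSum_succ (i n : ℕ) : pfSum i (n + 1) = pfSum i n + pfSign (i + n) :=
  Finset.sum_range_succ _ _

lemma pfSum_succ' (i n : ℕ) : pfSum i (n + 1) = pfSign i + pfSum (i + 1) n := by
  rw [pfSum, Finset.sum_range_succ', add_comm, pfSum]
  simp only [add_zero, add_assoc, add_comm 1]

lemma pfSign_odd_add_pfSign_odd (m : ℕ) : pfSign (2 * m + 1) + pfSign (2 * m + 3) = 0 := by
  rcases Nat.mod_two_eq_zero_or_one m with h | h
  · rw [pfSign_of_mod_four_eq_one (by omega), pfSign_of_mod_four_eq_three (by omega)]; rfl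
  · rw [pfSign_of_mod_four_eq_three (by omega), pfSign_of_mod_four_eq_one (by omega)]; rfl

lemma pfSum_two_mul (i n : ℕ) : pfSum (2 * i) (4 * n) = pfSum i (2 * n) := by
  induction n with
  | zero => rfl
  | succ n ih =>
    have h := pfSign_odd_add_pfSign_odd (i + 2 * n)
    have h₀ := pfSign_two_mul (i + 2 * n)
    have h₁ := pfSign_two_mul (i + 2 * n + 1)
    simp only [Nat.mul_succ, pfSum_succ, ← add_assoc, ih]
    ring_nf at h h₀ h₁ ⊢
    linarith

lemma pfSum_two_mul_add_one (i n : ℕ) :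
    pfSum (2 * i + 1) (4 * n) = pfSum (i + 1) (2 * n) := by
  induction n with
  | zero => rfl
  | succ n ih =>
    have h := pfSign_odd_add_pfSign_odd (i + 2 * n)
    have h₀ := pfSign_two_mul (i + 2 * n + 1)
    have h₁ := pfSign_two_mul (i + 2 * n + 2)
    simp only [Nat.mul_succ, pfSum_succ, ← add_assoc, ih]
    ring_nf at h h₀ h₁ ⊢
    linarith

lemma pfSum_two_mul_sixteen_mul_add_one (i n : ℕ) :
    pfSum (2 * i) (16 * n + 1) = pfSum i (8 * n + 1) := by
  rw [pfSum_succ, pfSum_succ, show 16 * n = 4 * (4 * n) by ring, pfSum_two_mul,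
    show 2 * i + 4 * (4 * n) = 2 * (i + 8 * n) by ring, pfSign_two_mul]
  ring_nf

lemma pfSum_two_mul_add_one_sixteen_mul_add_one (i n : ℕ) :
    pfSum (2 * i + 1) (16 * n + 1) = pfSum (i + 1) (8 * n) + pfSign (2 * i + 1) := by
  rw [pfSum_succ, show 16 * n = 4 * (4 * n) by ring, pfSum_two_mul_add_one,
    pfSign_add_four_mul (by omega)]
  ring_nf

lemma exists_pfSum_eight_mul_add_one_eq (i n : ℕ) :
    ∃ k, 1 ≤ k ∧ pfSum k (8 * n + 1) = pfSum (i + 1) (8 * n) + pfSign (2 * i + 1) := by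
  have hmod : i % 4 = 0 ∨ i % 4 = 1 ∨ i % 4 = 2 ∨ i % 4 = 3 := by omega
  rcases hmod with h | h | h | h
  · refine ⟨i + 1, by omega, ?_⟩
    rw [pfSum_succ, pfSign_of_mod_four_eq_one (n := 2 * i + 1) (by omega),
      pfSign_of_mod_four_eq_one (by omega)]
  · refine ⟨i + 2, by omega, ?_⟩
    have e₁ := pfSum_succ (i + 1) (8 * n)
    have e₂ := pfSum_succ' (i + 1) (8 * n)
    rw [pfSign_add_eight_mul (by omega)] at e₁
    rw [pfSum_succ, pfSign_of_mod_four_eq_three (n := 2 * i + 1) (by omega),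
      pfSign_of_mod_four_eq_three (n := i + 2 + 8 * n) (by omega)]
    linarith
  · refine ⟨i - 1, by omega, ?_⟩
    obtain ⟨i, rfl⟩ : ∃ k, i = k + 1 := ⟨i - 1, by omega⟩
    have e₁ := pfSum_succ (i + 1) (8 * n)
    have e₂ := pfSum_succ' (i + 1) (8 * n)
    rw [pfSign_add_eight_mul (by omega)] at e₁
    rw [Nat.add_sub_cancel, pfSum_succ', pfSign_of_mod_four_eq_one (n := i) (by omega),
      pfSign_of_mod_four_eq_one (by omega)]
    linarith
  · refine ⟨i, by omega, ?_⟩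
    rw [pfSum_succ', pfSign_of_mod_four_eq_three (n := i) (by omega),
      pfSign_of_mod_four_eq_three (by omega), add_comm]

lemma setOf_pfSum_sixteen_mul_add_one (n : ℕ) :
    {d | ∃ i, 1 ≤ i ∧ d = pfSum i (16 * n + 1)} =
      {d | ∃ i, 1 ≤ i ∧ d = pfSum i (8 * n + 1)} := by
  ext d
  constructor
  · rintro ⟨i, hi, rfl⟩
    obtain ⟨m, rfl | rfl⟩ := Nat.even_or_odd' i
    · exact ⟨m, by omega, pfSum_two_mul_sixteen_mul_add_one m n⟩
    · obtain ⟨k, hk, h⟩ := exists_pfSum_eight_mul_add_one_eq m n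
      exact ⟨k, hk, by rw [h, pfSum_two_mul_add_one_sixteen_mul_add_one]⟩
  · rintro ⟨i, hi, rfl⟩
    exact ⟨2 * i, by omega, (pfSum_two_mul_sixteen_mul_add_one i n).symm⟩

lemma pfFactor_succ (i n : ℕ) : pfFactor i (n + 1) = pfFactor i n ++ [pf (i + n)] := by
  simp [pfFactor, List.range_succ]

lemma count_pfFactor_sub (i n : ℕ) :
    ((pfFactor i n).count 0 : ℤ) - (pfFactor i n).count 1 = pfSum i n := by
  induction n with
  | zero => rfl
  | succ n ih =>
    rw [pfFactor_succ, pfSum_succ, ← ih, pfSign]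
    rcases pf_eq_zero_or_one (i + n) with h | h <;> simp [h] <;> ring

lemma count_pfFactor_add (i n : ℕ) :
    (pfFactor i n).count 0 + (pfFactor i n).count 1 = n := by
  induction n with
  | zero => rfl
  | succ n ih =>
    rw [pfFactor_succ]
    rcases pf_eq_zero_or_one (i + n) with h | h <;> simp [h] <;> omega

lemma rho_eq_ncard_pfSum (n : ℕ) : ρ n = {d | ∃ i, 1 ≤ i ∧ d = pfSum i n}.ncard := by
  have himage : {d | ∃ i, 1 ≤ i ∧ d = pfSum i n} =
      (fun p : ℕ × ℕ => (p.1 : ℤ) - p.2) '' {p : ℕ × ℕ | ∃ i : ℕ, 1 ≤ i ∧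
        p = ((pfFactor i n).count 0, (pfFactor i n).count 1)} := by
    ext d
    constructor
    · rintro ⟨i, hi, rfl⟩
      exact ⟨_, ⟨i, hi, rfl⟩, count_pfFactor_sub i n⟩
    · rintro ⟨_, ⟨i, hi, rfl⟩, rfl⟩
      exact ⟨i, hi, count_pfFactor_sub i n⟩
  rw [ρ, himage, Set.InjOn.ncard_image]
  rintro _ ⟨i, -, rfl⟩ _ ⟨j, -, rfl⟩ h
  have hi := count_pfFactor_add i n
  have hj := count_pfFactor_add j n
  simp only at h
  ext <;> simp only <;> omega

theorem pf_rho_sixteen_mul_add_one : ∀ n : ℕ, ρ (16 * n + 1) = ρ (8 * n + 1) := by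
  intro n
  rw [rho_eq_ncard_pfSum, rho_eq_ncard_pfSum, setOf_pfSum_sixteen_mul_add_one]
end

section
/- For every n ≥ 1, the set Δ(B_n) = {Δ(w) : w ∈ B_n} of values of Δ over factors of the ordinary paperfolding word of length n equals the set of all integers k with −M(n) ≤ k ≤ M(n) and k ≡ n (mod 2); in particular, consecutive values of Δ(B_n), listed in increasing order, differ by exactly 2. -/
theorem pf_two_pow_mul_odd (v m : ℕ) (hm : Odd m) :
    pf (2 ^ v * m) = if m % 4 = 1 then 0 else 1 := by
  have hm0 : m ≠ 0 := by rintro rfl; simp at hm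
  have hv : (2 ^ v * m).factorization 2 = v := by
    rw [Nat.factorization_mul (by positivity) hm0, Nat.prime_two.factorization_pow]
    simp [Nat.factorization_eq_zero_of_not_dvd hm.not_two_dvd_nat]
  rw [pf, hv, Nat.mul_div_cancel_left _ (by positivity)]

theorem pf_two_pow_sub {k j : ℕ} (hj : 0 < j) (hk : 2 * j < 2 ^ k) :
    pf (2 ^ k - j) + pf j = 1 := by
  obtain ⟨v, m, hm, rfl⟩ := Nat.exists_eq_two_pow_mul_odd hj.ne'
  have hmpos : 0 < m := hm.pos
  have hvk : v + 1 < k := by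
    refine (Nat.pow_lt_pow_iff_right one_lt_two).1 (lt_of_le_of_lt ?_ hk)
    rw [pow_succ]
    nlinarith [Nat.two_pow_pos v]
  obtain ⟨t, rfl⟩ : ∃ t, k = v + (t + 2) := ⟨k - v - 2, by omega⟩
  have hlt : 2 * m < 2 ^ (t + 2) := by
    rw [pow_add 2 v] at hk
    nlinarith [Nat.two_pow_pos v]
  rw [pow_add 2 v, ← Nat.mul_sub]
  have h4 : 2 ^ (t + 2) = 4 * 2 ^ t := by ring
  rw [h4] at hlt ⊢
  obtain ⟨r, rfl⟩ := hm
  rw [pf_two_pow_mul_odd _ _ ⟨2 * 2 ^ t - r - 1, by omega⟩,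
    pf_two_pow_mul_odd _ _ ⟨r, rfl⟩]
  split_ifs <;> omega

theorem pf_le_one (j : ℕ) : pf j ≤ 1 := by
  unfold pf; split_ifs <;> simp

theorem Δ_pfFactor (i n : ℕ) :
    Δ (pfFactor i n) = ∑ j ∈ Finset.range n, (1 - 2 * (pf (i + j) : ℤ)) := by
  induction n with
  | zero => simp [Δ, pfFactor]
  | succ n ih =>
    rw [Finset.sum_range_succ, ← ih]
    have hle := pf_le_one (i + n)
    simp only [Δ, pfFactor, List.range_succ, List.map_append, List.count_append, List.map_cons,
      List.map_nil, List.count_singleton]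
    interval_cases pf (i + n) <;> simp <;> ring

theorem Δ_pfFactor_shift (i n : ℕ) :
    Δ (pfFactor (i + 1) n) = Δ (pfFactor i n) + 2 * (pf i : ℤ) - 2 * (pf (i + n) : ℤ) := by
  have h := Finset.sum_range_succ' (fun j => 1 - 2 * (pf (i + j) : ℤ)) n
  rw [Finset.sum_range_succ] at h
  simp only [Δ_pfFactor, add_right_comm i 1, add_assoc i]
  simp only [add_zero] at h
  linarith

theorem Δ_pfFactor_emod_two (i n : ℕ) : Δ (pfFactor i n) % 2 = (n : ℤ) % 2 := by
  rw [Δ_pfFactor, Finset.sum_sub_distrib, ← Finset.mul_sum]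
  simp

theorem Δ_pfFactor_le (i n : ℕ) : Δ (pfFactor i n) ≤ n := by
  rw [Δ_pfFactor]
  calc _ ≤ ∑ j ∈ Finset.range n, (1 : ℤ) := Finset.sum_le_sum fun j _ => by omega
    _ = n := by simp

theorem Δ_pfFactor_reflect {i n k : ℕ} (hi : 1 ≤ i) (hk : 2 * (i + n) < 2 ^ k) :
    Δ (pfFactor (2 ^ k + 1 - (i + n)) n) = -Δ (pfFactor i n) := by
  rw [Δ_pfFactor, Δ_pfFactor, ← Finset.sum_range_reflect, ← Finset.sum_neg_distrib]
  refine Finset.sum_congr rfl fun j hj => ?_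
  rw [Finset.mem_range] at hj
  have h := pf_two_pow_sub (k := k) (j := i + j) (by omega) (by omega)
  rw [show 2 ^ k + 1 - (i + n) + (n - 1 - j) = 2 ^ k - (i + j) by omega]
  omega

theorem exists_eq_of_sub_two_le {F : ℕ → ℤ} {k : ℤ} (hstep : ∀ i, F i - 2 ≤ F (i + 1))
    (hparity : ∀ i, F i % 2 = k % 2) (a m : ℕ) (ha : k ≤ F a) (hm : F (a + m) ≤ k) :
    ∃ i, a ≤ i ∧ F i = k := by
  induction m with
  | zero => exact ⟨a, le_rfl, le_antisymm hm ha⟩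
  | succ m ih =>
    by_cases h : F (a + m) ≤ k
    · exact ih h
    · refine ⟨a + (m + 1), by omega, ?_⟩
      have h1 := hstep (a + m)
      have h2 := hparity (a + m)
      rw [← add_assoc] at hm ⊢
      omega

/-- For `n ≥ 1`, the set of values of `Δ` over factors of length `n` of the
paperfolding word is exactly the set of integers `k` with `-M(n) ≤ k ≤ M(n)`
and `k ≡ n (mod 2)`; in particular consecutive values differ by `2`. -/
theorem pf_Delta_values (n : ℕ) (hn : 1 ≤ n) :
    {d : ℤ | ∃ i : ℕ, 1 ≤ i ∧ d = Δ (pfFactor i n)} =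
      {k : ℤ | -M n ≤ k ∧ k ≤ M n ∧ k % 2 = (n : ℤ) % 2} := by
  have hbdd : BddAbove {d : ℤ | ∃ i : ℕ, 1 ≤ i ∧ d = Δ (pfFactor i n)} :=
    ⟨n, by rintro _ ⟨i, -, rfl⟩; exact Δ_pfFactor_le i n⟩
  have hpow (i : ℕ) : 2 * (i + n) < 2 ^ (2 * (i + n)) := Nat.lt_two_pow_self
  ext k
  constructor
  · rintro ⟨i, hi, rfl⟩
    refine ⟨neg_le.1 ?_, le_csSup hbdd ⟨i, hi, rfl⟩, Δ_pfFactor_emod_two i n⟩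
    rw [← Δ_pfFactor_reflect hi (hpow i)]
    exact le_csSup hbdd ⟨_, by have := hpow i; omega, rfl⟩
  · rintro ⟨hlow, hhigh, hparity⟩
    obtain ⟨a, ha, hMa⟩ : ∃ i : ℕ, 1 ≤ i ∧ M n = Δ (pfFactor i n) :=
      Int.csSup_mem (s := {d : ℤ | ∃ i : ℕ, 1 ≤ i ∧ d = Δ (pfFactor i n)}) ⟨_, 1, le_rfl, rfl⟩ hbdd
    have hlt := hpow a
    have hreflect := Δ_pfFactor_reflect ha hlt
    obtain ⟨i, hai, hi⟩ := exists_eq_of_sub_two_le (F := fun i => Δ (pfFactor i n)) (k := k)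
      (fun i => by
        have := pf_le_one (i + n)
        rw [Δ_pfFactor_shift]
        omega)
      (fun i => by rw [Δ_pfFactor_emod_two, hparity])
      a (2 ^ (2 * (a + n)) + 1 - (a + n) - a) (hMa ▸ hhigh)
      (by
        rw [Nat.add_sub_cancel' (by omega), hreflect, ← hMa]
        exact hlow)
    exact ⟨i, ha.trans hai, hi.symm⟩
end
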